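/- arXiv:math/0612080 — 3 statements merged into one kernel-verified Lean document; each statement's English description precedes it below -/
import Mathlib

section
/- For every n ≥ 0 and every index i < 3ⁿ, the i-th entry of the list W_n equals w(i). (In particular the lists W_n converge to the infinite sequence w.) -/
/- The sign sequence w : ℕ → ℤ with w(0) = 1, w(3n) = 1, w(3n+1) = w(n),
   w(3n+2) = −1. -/
def signw : ℕ → ℤ
  | 0 => 1
  | (n+1) =>
    if (n+1) % 3 = 0 then 1
    else if (n+1) % 3 = 2 then -1
    else signw ((n+1)/3)
decreasing_by exact Nat.div_lt_self (Nat.succ_pos n) (by norm_num)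

/- The lists W_n of length 3ⁿ: W_0 = [1], W_{n+1} = W_n ++ W_n ++ W_n′, where
   W_n′ is W_n with the middle entry (at index (3ⁿ−1)/2) replaced by −1. -/
def Wlist : ℕ → List ℤ
  | 0 => [1]
  | n+1 => Wlist n ++ Wlist n ++ (Wlist n).set ((3^n - 1) / 2) (-1)

theorem signw_three_mul (k : ℕ) : signw (3 * k) = 1 := by
  cases k with
  | zero => simp [signw]
  | succ k =>
    rw [show 3 * (k + 1) = 3 * k + 2 + 1 by ring, signw]
    exact if_pos (by omega)

theorem signw_three_mul_add_one (k : ℕ) : signw (3 * k + 1) = signw k := by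
  rw [signw, if_neg (by omega), if_neg (by omega)]
  congr 1
  omega

theorem signw_three_mul_add_two (k : ℕ) : signw (3 * k + 2) = -1 := by
  rw [show 3 * k + 2 = 3 * k + 1 + 1 by ring, signw, if_neg (by omega), if_pos (by omega)]

theorem three_pow_eq_two_mul_add_one (n : ℕ) : 3 ^ n = 2 * ((3 ^ n - 1) / 2) + 1 := by
  have h : Odd (3 ^ n) := Odd.pow (by decide)
  obtain ⟨k, hk⟩ := h
  omega

/-- The sequence `signw` on the second and third blocks of length `3 ^ n`: the second one repeats
the first, and the third one repeats it except for its middle entry. -/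
theorem signw_three_pow_add (n : ℕ) : ∀ i < 3 ^ n, signw (3 ^ n + i) = signw i ∧
    signw (2 * 3 ^ n + i) = if i = (3 ^ n - 1) / 2 then -1 else signw i := by
  induction n with
  | zero =>
    intro i hi
    obtain rfl : i = 0 := by simpa using hi
    have h₁ := signw_three_mul_add_one 0
    have h₂ := signw_three_mul_add_two 0
    simp_all
  | succ n ih =>
    intro i hi
    have hm := three_pow_eq_two_mul_add_one n
    have hmid : (3 ^ (n + 1) - 1) / 2 = 3 * ((3 ^ n - 1) / 2) + 1 := by
      rw [pow_succ]
      omega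
    rw [hmid, pow_succ']
    rw [pow_succ'] at hi
    obtain ⟨j, rfl | rfl | rfl⟩ : ∃ j, i = 3 * j ∨ i = 3 * j + 1 ∨ i = 3 * j + 2 :=
      ⟨i / 3, by omega⟩
    · rw [if_neg (by omega), ← mul_add, mul_left_comm, ← mul_add]
      simp only [signw_three_mul, and_self]
    · rw [← add_assoc, ← add_assoc, ← mul_add, mul_left_comm 2, ← mul_add]
      simpa only [signw_three_mul_add_one, Nat.add_right_cancel_iff,
        Nat.mul_right_inj three_ne_zero] using ih j (by omega)
    · rw [if_neg (by omega), ← add_assoc, ← add_assoc, ← mul_add, mul_left_comm 2, ← mul_add]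
      simp only [signw_three_mul_add_two, and_self]

/-- For every n and every i < 3ⁿ, the i-th entry of W_n equals w(i). -/
theorem stmt_2 :
    ∀ n : ℕ, (Wlist n).length = 3^n ∧ ∀ i < 3^n, (Wlist n).getD i 0 = signw i := by
  intro n
  induction n with
  | zero => simp [Wlist, signw]
  | succ n ih =>
    obtain ⟨hlen, hget⟩ := ih
    refine ⟨by simp only [Wlist, List.length_append, List.length_set, hlen]; ring, fun i hi => ?_⟩
    rw [pow_succ] at hi
    rw [Wlist]
    rcases lt_or_ge i (3 ^ n) with h₁ | h₁
    · rw [List.append_assoc, List.getD_append _ _ _ _ (by omega)]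
      exact hget i h₁
    rcases lt_or_ge i (2 * 3 ^ n) with h₂ | h₂
    · obtain ⟨j, rfl⟩ := Nat.exists_eq_add_of_le h₁
      rw [List.getD_append _ _ _ _ (by simp only [List.length_append]; omega),
        List.getD_append_right _ _ _ _ (by omega), hlen, Nat.add_sub_cancel_left,
        hget j (by omega), (signw_three_pow_add n j (by omega)).1]
    · obtain ⟨j, rfl⟩ := Nat.exists_eq_add_of_le h₂
      have hj : j < 3 ^ n := by omega
      rw [List.getD_append_right _ _ _ _ (by simp only [List.length_append]; omega),
        List.length_append, hlen, ← two_mul, Nat.add_sub_cancel_left,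
        (signw_three_pow_add n j hj).2, ← hget j hj]
      simp only [List.getD_eq_getElem?_getD, List.getElem?_set, hlen]
      split_ifs <;> first | omega | simp
end

section
/- The L-sequence satisfies ℓ(0) = 0, ℓ(1) = 1, and for every n ≥ 1: ℓ(3n − 1) = 3ℓ(n) + 1, ℓ(3n) = 3ℓ(n), and ℓ(3n + 1) = 3ℓ(n) + 1. (This expresses ℓ as the fixed point, starting from 0, of the substitution 0 ↦ 0, 1 and x ↦ 3x+1, 3x, 3x+1 for x ≥ 1.) -/
/- N₂: natural numbers all of whose ternary digits are 0 or 1. -/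
def N2 (n : ℕ) : Prop := ∀ k : ℕ, (n / 3^k) % 3 ≤ 1

/- The L-sequence: ℓ(n) = p + q where (p,q) is the unique pair with
   p, q, p+q ∈ N₂ and p − q = n. -/
def IsLSeq (l : ℕ → ℕ) : Prop :=
  ∀ n : ℕ, ∃ p q : ℕ, N2 p ∧ N2 q ∧ N2 (p + q) ∧ (p : ℤ) - (q : ℤ) = (n : ℤ) ∧ l n = p + q

theorem N2_zero : N2 0 := fun k => by simp

theorem N2_iff_div_three (n : ℕ) : N2 n ↔ n % 3 ≤ 1 ∧ N2 (n / 3) := by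
  have shift (k : ℕ) : n / 3 / 3 ^ k = n / 3 ^ (k + 1) := by
    rw [Nat.div_div_eq_div_mul, pow_succ']
  refine ⟨fun h => ⟨by simpa using h 0, fun k => ?_⟩, fun ⟨h0, h⟩ k => ?_⟩
  · rw [shift]
    exact h (k + 1)
  · cases k with
    | zero => simpa using h0
    | succ k =>
      rw [← shift]
      exact h k

theorem N2_three_mul {n : ℕ} (h : N2 n) : N2 (3 * n) := by
  rw [N2_iff_div_three, show 3 * n / 3 = n by omega]
  exact ⟨by omega, h⟩

theorem N2_three_mul_add_one {n : ℕ} (h : N2 n) : N2 (3 * n + 1) := by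
  rw [N2_iff_div_three, show (3 * n + 1) / 3 = n by omega]
  exact ⟨by omega, h⟩

theorem N2_pair_unique {p q p' q' : ℕ} (hp : N2 p) (hq : N2 q) (hs : N2 (p + q))
    (hp' : N2 p') (hq' : N2 q') (hs' : N2 (p' + q')) (h : p + q' = p' + q) :
    p = p' ∧ q = q' := by
  induction hN : p + q + p' + q' using Nat.strong_induction_on generalizing p q p' q' with
  | _ N ih =>
    subst hN
    by_cases h0 : p + q + p' + q' = 0
    · omega
    rw [N2_iff_div_three] at hp hq hs hp' hq' hs'
    have hdiv : (p + q) / 3 = p / 3 + q / 3 := by omega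
    have hdiv' : (p' + q') / 3 = p' / 3 + q' / 3 := by omega
    have := ih (p / 3 + q / 3 + p' / 3 + q' / 3) (by omega) hp.2 hq.2 (hdiv ▸ hs.2)
      hp'.2 hq'.2 (hdiv' ▸ hs'.2) (by omega) rfl
    omega

theorem IsLSeq.eq_add {l : ℕ → ℕ} (hl : IsLSeq l) {n p q : ℕ} (hp : N2 p) (hq : N2 q)
    (hs : N2 (p + q)) (h : p = q + n) : l n = p + q := by
  obtain ⟨p', q', hp', hq', hs', h', e⟩ := hl n
  have := N2_pair_unique hp hq hs hp' hq' hs' (by omega)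
  omega

/-- The L-sequence satisfies ℓ(0) = 0, ℓ(1) = 1 and, for n ≥ 1,
    ℓ(3n−1) = 3ℓ(n)+1, ℓ(3n) = 3ℓ(n), ℓ(3n+1) = 3ℓ(n)+1. -/
theorem stmt_9 :
    ∀ l : ℕ → ℕ, IsLSeq l →
      l 0 = 0 ∧ l 1 = 1 ∧
      ∀ n : ℕ, 1 ≤ n →
        l (3*n - 1) = 3 * l n + 1 ∧ l (3*n) = 3 * l n ∧ l (3*n + 1) = 3 * l n + 1 := by
  intro l hl
  have N2_one : N2 1 := N2_three_mul_add_one N2_zero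
  refine ⟨hl.eq_add N2_zero N2_zero N2_zero rfl, hl.eq_add N2_one N2_zero N2_one rfl, ?_⟩
  intro n hn
  obtain ⟨p, q, hp, hq, hs, h, e⟩ := hl n
  have hs0 : N2 (3 * p + 3 * q) := by
    rw [← mul_add]
    exact N2_three_mul hs
  have hs1 : N2 (3 * p + (3 * q + 1)) := by
    rw [← add_assoc, ← mul_add]
    exact N2_three_mul_add_one hs
  have hs2 : N2 (3 * p + 1 + 3 * q) := by
    rw [add_right_comm]
    exact hs1
  have e1 := hl.eq_add (n := 3 * n - 1) (N2_three_mul hp) (N2_three_mul_add_one hq) hs1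
    (by omega)
  have e2 := hl.eq_add (n := 3 * n) (N2_three_mul hp) (N2_three_mul hq) hs0 (by omega)
  have e3 := hl.eq_add (n := 3 * n + 1) (N2_three_mul_add_one hp) (N2_three_mul hq) hs2
    (by omega)
  omega
end

section
/- The transducer O_H generates the optimal configurations in the Hanoi Towers Problem from Gray code input: let x, y be distinct elements of {0,1,2} and n ≥ 1, and for 0 ≤ i < 2ⁿ set c_i = reverse(t_{xy}(reverse(M_n[i]))), where M_n[i] is the i-th binary Gray code word of length n. Then c_0 = xⁿ (the constant word x of length n), c_{2ⁿ−1} = yⁿ, the words c_0, …, c_{2ⁿ−1} are pairwise distinct, and for every i < 2ⁿ − 1 there exist distinct u, v ∈ {0,1,2} with c_{i+1} = a_{uv}(c_i); that is, the c_i form a path of length 2ⁿ − 1 of legal Hanoi moves from the configuration xⁿ to the configuration yⁿ. -/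
/- a_{ij} : changes the first occurrence of i or j in a word to the other
   symbol (a legal Hanoi move between pegs i and j). -/
def amap (i j : Fin 3) : List (Fin 3) → List (Fin 3)
  | [] => []
  | x :: w => if x = i then j :: w else if x = j then i :: w else x :: amap i j w

/- The states t_{xy} of the 2-to-3 transducer O_H: for distinct x y with
   third element z = -(x+y) (in Fin 3, since 0+1+2 = 0),
   t_{xy}(0·w) = x·t_{xz}(w), t_{xy}(1·w) = y·t_{yz}(w). -/
def tmap : Fin 3 → Fin 3 → List (Fin 2) → List (Fin 3)
  | _, _, [] => []
  | x, y, d :: w => if d = 0 then x :: tmap x (-(x+y)) w else y :: tmap y (-(x+y)) w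

/- The lists M_n of binary Gray code words of length n: M_0 = [ε],
   M_{n+1} = (M_n · 0) ++ (reverse M_n · 1), so that M_1 = [[0],[1]]. -/
def Mn : ℕ → List (List (Fin 2))
  | 0 => [[]]
  | n+1 => (Mn n).map (· ++ [0]) ++ ((Mn n).reverse.map (· ++ [1]))

theorem length_Mn (n : ℕ) : (Mn n).length = 2 ^ n := by
  induction n with
  | zero => rfl
  | succ n ih => simp [Mn, ih, pow_succ]; omega

theorem getD_Mn_succ_of_lt {n i : ℕ} (h : i < 2 ^ n) :
    (Mn (n + 1)).getD i [] = (Mn n).getD i [] ++ [0] := by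
  have hi : i < (Mn n).length := by rwa [length_Mn]
  rw [Mn, List.getD_append _ _ _ _ (by simpa using hi)]
  simp [List.getD_eq_getElem?_getD, hi]

theorem getD_Mn_succ_of_le {n i : ℕ} (h : 2 ^ n ≤ i) (h' : i < 2 ^ (n + 1)) :
    (Mn (n + 1)).getD i [] = (Mn n).getD (2 ^ (n + 1) - 1 - i) [] ++ [1] := by
  have hp : 2 ^ (n + 1) = 2 ^ n + 2 ^ n := by ring
  have hi : i - 2 ^ n < (Mn n).length := by rw [length_Mn]; omega
  have hj : 2 ^ (n + 1) - 1 - i < (Mn n).length := by rw [length_Mn]; omega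
  have e : 2 ^ n - 1 - (i - 2 ^ n) = 2 ^ (n + 1) - 1 - i := by omega
  rw [Mn, List.getD_append_right _ _ _ _ (by simpa [length_Mn] using h)]
  simp only [List.getD_eq_getElem?_getD, List.length_map, length_Mn, List.getElem?_map,
    List.getElem?_reverse hi, e, List.getElem?_eq_getElem hj, Option.map_some, Option.getD_some]

/-- The `i`-th configuration produced by the transducer in state `t_{xy}` from the Gray code. -/
def hanoiConf (x y : Fin 3) (n i : ℕ) : List (Fin 3) :=
  (tmap x y ((Mn n).getD i []).reverse).reverse

theorem hanoiConf_succ_of_lt (x y : Fin 3) {n i : ℕ} (h : i < 2 ^ n) :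
    hanoiConf x y (n + 1) i = hanoiConf x (-(x + y)) n i ++ [x] := by
  rw [hanoiConf, getD_Mn_succ_of_lt h]
  simp [tmap, hanoiConf]

theorem hanoiConf_succ_of_le (x y : Fin 3) {n i : ℕ} (h : 2 ^ n ≤ i) (h' : i < 2 ^ (n + 1)) :
    hanoiConf x y (n + 1) i = hanoiConf y (-(x + y)) n (2 ^ (n + 1) - 1 - i) ++ [y] := by
  rw [hanoiConf, getD_Mn_succ_of_le h h']
  simp [tmap, hanoiConf]

theorem hanoiConf_first (x y : Fin 3) (n : ℕ) :
    hanoiConf x y n 0 = List.replicate n x := by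
  induction n generalizing y with
  | zero => rfl
  | succ n ih => rw [hanoiConf_succ_of_lt x y (by positivity), ih, List.replicate_succ']

theorem hanoiConf_last (x y : Fin 3) (n : ℕ) :
    hanoiConf x y n (2 ^ n - 1) = List.replicate n y := by
  cases n with
  | zero => rfl
  | succ n =>
    have hp : 2 ^ (n + 1) = 2 ^ n + 2 ^ n := by ring
    have : 0 < 2 ^ n := by positivity
    rw [hanoiConf_succ_of_le x y (by omega) (by omega), Nat.sub_self, hanoiConf_first,
      List.replicate_succ']

theorem ne_neg_add {x y : Fin 3} (h : x ≠ y) : x ≠ -(x + y) ∧ y ≠ -(x + y) := by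
  revert x y; decide

theorem hanoiConf_injOn {x y : Fin 3} (h : x ≠ y) (n : ℕ) {i j : ℕ} (hi : i < 2 ^ n)
    (hj : j < 2 ^ n) (hij : hanoiConf x y n i = hanoiConf x y n j) : i = j := by
  induction n generalizing x y i j with
  | zero => simp at hi hj; omega
  | succ n ih =>
    have hp : 2 ^ (n + 1) = 2 ^ n + 2 ^ n := by ring
    obtain ⟨hx, hy⟩ := ne_neg_add h
    rcases lt_or_ge i (2 ^ n) with h₁ | h₁ <;> rcases lt_or_ge j (2 ^ n) with h₂ | h₂
    · rw [hanoiConf_succ_of_lt x y h₁, hanoiConf_succ_of_lt x y h₂] at hij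
      exact ih hx h₁ h₂ (List.append_cancel_right hij)
    · rw [hanoiConf_succ_of_lt x y h₁, hanoiConf_succ_of_le x y h₂ hj] at hij
      exact absurd (List.append_inj' hij rfl).2 (by simpa using h)
    · rw [hanoiConf_succ_of_le x y h₁ hi, hanoiConf_succ_of_lt x y h₂] at hij
      exact absurd (List.append_inj' hij rfl).2 (by simpa using h.symm)
    · rw [hanoiConf_succ_of_le x y h₁ hi, hanoiConf_succ_of_le x y h₂ hj] at hij
      have := ih hy (by omega) (by omega) (List.append_cancel_right hij)
      omega

theorem amap_amap (u v : Fin 3) (w : List (Fin 3)) : amap u v (amap u v w) = w := by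
  induction w with
  | nil => rfl
  | cons a w ih =>
    by_cases h₁ : a = u <;> by_cases h₂ : a = v <;> simp_all [amap]

theorem amap_append_of_ne {u v : Fin 3} {w : List (Fin 3)} (s : List (Fin 3))
    (h : amap u v w ≠ w) : amap u v (w ++ s) = amap u v w ++ s := by
  induction w with
  | nil => exact absurd rfl h
  | cons a w ih =>
    by_cases h₁ : a = u <;> by_cases h₂ : a = v <;> simp_all [amap]

theorem amap_replicate_append {a u v : Fin 3} (hu : a ≠ u) (hv : a ≠ v) (n : ℕ)
    (s : List (Fin 3)) :
    amap u v (List.replicate n a ++ s) = List.replicate n a ++ amap u v s := by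
  induction n with
  | zero => rfl
  | succ n ih => simp [List.replicate_succ, amap, hu, hv, ih]

theorem hanoiConf_step {x y : Fin 3} (h : x ≠ y) (n : ℕ) {i : ℕ} (hi : i + 1 < 2 ^ n) :
    ∃ u v : Fin 3, u ≠ v ∧ hanoiConf x y n (i + 1) = amap u v (hanoiConf x y n i) := by
  induction n generalizing x y i with
  | zero => simp at hi
  | succ n ih =>
    have hp : 2 ^ (n + 1) = 2 ^ n + 2 ^ n := by ring
    obtain ⟨hx, hy⟩ := ne_neg_add h
    rcases lt_trichotomy (i + 1) (2 ^ n) with h₁ | h₁ | h₁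
    · obtain ⟨u, v, huv, e⟩ := ih hx h₁
      refine ⟨u, v, huv, ?_⟩
      have hne : amap u v (hanoiConf x (-(x + y)) n i) ≠ hanoiConf x (-(x + y)) n i := by
        rw [← e]
        intro he
        have := hanoiConf_injOn hx n h₁ (by omega) he
        omega
      rw [hanoiConf_succ_of_lt x y h₁, hanoiConf_succ_of_lt x y (by omega : i < 2 ^ n),
        amap_append_of_ne _ hne, e]
    · refine ⟨x, y, h, ?_⟩
      have e₁ : 2 ^ (n + 1) - 1 - (i + 1) = 2 ^ n - 1 := by omega
      have e₂ : i = 2 ^ n - 1 := by omega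
      rw [hanoiConf_succ_of_le x y h₁.ge hi, e₁, hanoiConf_last,
        hanoiConf_succ_of_lt x y (by omega : i < 2 ^ n), e₂, hanoiConf_last,
        amap_replicate_append hx.symm hy.symm]
      simp [amap]
    · obtain ⟨k, hk⟩ : ∃ k, k = 2 ^ (n + 1) - 1 - (i + 1) := ⟨_, rfl⟩
      have hk' : 2 ^ (n + 1) - 1 - i = k + 1 := by omega
      have hkn : k + 1 < 2 ^ n := by omega
      obtain ⟨u, v, huv, e⟩ := ih hy hkn
      refine ⟨u, v, huv, ?_⟩
      have e' : amap u v (hanoiConf y (-(x + y)) n (k + 1)) = hanoiConf y (-(x + y)) n k := by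
        rw [e, amap_amap]
      have hne : amap u v (hanoiConf y (-(x + y)) n (k + 1)) ≠
          hanoiConf y (-(x + y)) n (k + 1) := by
        rw [e']
        intro he
        have := hanoiConf_injOn hy n (by omega) hkn he
        omega
      rw [hanoiConf_succ_of_le x y h₁.le hi, hanoiConf_succ_of_le x y (by omega) (by omega), hk',
        ← hk, amap_append_of_ne _ hne, e']

/-- The transducer O_H generates the optimal Hanoi configurations from Gray
    code input: with c_i = reverse(t_{xy}(reverse(M_n[i]))), the words
    c_0, …, c_{2ⁿ−1} form a path of legal Hanoi moves from xⁿ to yⁿ,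
    pairwise distinct. -/
theorem stmt_19 :
    ∀ x y : Fin 3, x ≠ y → ∀ n : ℕ, 1 ≤ n →
      let c : ℕ → List (Fin 3) := fun i => (tmap x y ((Mn n).getD i []).reverse).reverse
      c 0 = List.replicate n x ∧
      c (2^n - 1) = List.replicate n y ∧
      (∀ i < 2^n, ∀ j < 2^n, c i = c j → i = j) ∧
      (∀ i : ℕ, i + 1 < 2^n → ∃ u v : Fin 3, u ≠ v ∧ c (i+1) = amap u v (c i)) := by
  intro x y h n _
  exact ⟨hanoiConf_first x y n, hanoiConf_last x y n,
    fun _ hi _ hj => hanoiConf_injOn h n hi hj, fun _ hi => hanoiConf_step h n hi⟩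
end
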